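/- Sphere-packing bound: for any code 𝒞 ⊆ Π with at least two elements, setting r = ⌊(d_MC(𝒞) − 1)/2⌋, we have B_r · |𝒞| ≤ q^{Σ_{i=1}^ℓ m_i n_i}. -/

import Mathlib

open Finset

/-- The space `∏_{i=1}^ℓ 𝔽_q^{m_i × n_i}` of `ℓ`-tuples of matrices over `F`. -/
abbrev MCSpace (F : Type*) {ℓ : ℕ} (m n : Fin ℓ → ℕ) : Type _ :=
  (i : Fin ℓ) → Matrix (Fin (m i)) (Fin (n i)) F

section Defs

variable {F : Type*} [Field F] [Fintype F] {ℓ : ℕ} {m n : Fin ℓ → ℕ}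

/-- `(X, Y)` is a multi-cover of the tuple of matrices `C`: every nonzero entry of `C i`
lies in a row indexed by `X i` or a column indexed by `Y i`. -/
def IsMultiCover (X : (i : Fin ℓ) → Finset (Fin (m i))) (Y : (i : Fin ℓ) → Finset (Fin (n i)))
    (C : MCSpace F m n) : Prop :=
  ∀ i a b, C i a b ≠ 0 → a ∈ X i ∨ b ∈ Y i

/-- The size `Σ_i (|X_i| + |Y_i|)` of a multi-cover. -/
def mcSize {ℓ : ℕ} {m n : Fin ℓ → ℕ} (X : (i : Fin ℓ) → Finset (Fin (m i)))
    (Y : (i : Fin ℓ) → Finset (Fin (n i))) : ℕ :=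
  ∑ i, ((X i).card + (Y i).card)

/-- The multi-cover weight: the minimum size of a multi-cover of `C`. -/
noncomputable def wtMC (C : MCSpace F m n) : ℕ :=
  sInf {r | ∃ X Y, IsMultiCover X Y C ∧ mcSize X Y = r}

/-- The minimum multi-cover distance of a code. -/
noncomputable def dMC (𝒞 : Set (MCSpace F m n)) : ℕ :=
  sInf {r | ∃ C ∈ 𝒞, ∃ D ∈ 𝒞, C ≠ D ∧ wtMC (C - D) = r}

/-- The column Hamming weight: the number of nonzero columns among the matrices `C i`. -/
noncomputable def wtHC (C : MCSpace F m n) : ℕ :=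
  ∑ i, Set.ncard {b : Fin (n i) | ∃ a, C i a b ≠ 0}

/-- The minimum column Hamming distance of a code. -/
noncomputable def dHC (𝒞 : Set (MCSpace F m n)) : ℕ :=
  sInf {r | ∃ C ∈ 𝒞, ∃ D ∈ 𝒞, C ≠ D ∧ wtHC (C - D) = r}

/-- The projection `π_X` removing, in each block `i`, the rows indexed by `X i` and the
columns indexed by `Y i` (the remaining rows and columns are re-indexed in order). -/
noncomputable def projMC (X : (i : Fin ℓ) → Finset (Fin (m i)))
    (Y : (i : Fin ℓ) → Finset (Fin (n i))) (C : MCSpace F m n) :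
    MCSpace F (fun i => m i - (X i).card) (fun i => n i - (Y i).card) :=
  fun i a b =>
    C i ((X i)ᶜ.orderIsoOfFin (by simp [Finset.card_compl]) a)
        ((Y i)ᶜ.orderIsoOfFin (by simp [Finset.card_compl]) b)

/-- The projection `π_X` as a linear map. -/
noncomputable def projMCLin (X : (i : Fin ℓ) → Finset (Fin (m i)))
    (Y : (i : Fin ℓ) → Finset (Fin (n i))) :
    MCSpace F m n →ₗ[F] MCSpace F (fun i => m i - (X i).card) (fun i => n i - (Y i).card) where
  toFun := projMC X Y
  map_add' _ _ := rfl
  map_smul' _ _ := rfl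

/-- The punctured code `𝒞_X = π_X(𝒞)`. -/
noncomputable def punctureMC (𝒞 : Submodule F (MCSpace F m n))
    (X : (i : Fin ℓ) → Finset (Fin (m i))) (Y : (i : Fin ℓ) → Finset (Fin (n i))) :
    Submodule F (MCSpace F (fun i => m i - (X i).card) (fun i => n i - (Y i).card)) :=
  Submodule.map (projMCLin X Y) 𝒞

/-- The subspace of tuples vanishing on all entries covered by `(X, Y)`. -/
def zeroOnMC (X : (i : Fin ℓ) → Finset (Fin (m i))) (Y : (i : Fin ℓ) → Finset (Fin (n i))) :
    Submodule F (MCSpace F m n) where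
  carrier := {C | ∀ i a b, (a ∈ X i ∨ b ∈ Y i) → C i a b = 0}
  zero_mem' := by intro i a b _; rfl
  add_mem' := by
    intro C D hC hD i a b hab
    show C i a b + D i a b = 0
    rw [hC i a b hab, hD i a b hab, add_zero]
  smul_mem' := by
    intro c C hC i a b hab
    show c * C i a b = 0
    rw [hC i a b hab, mul_zero]

/-- The shortened code `𝒞^X`. -/
noncomputable def shortenMC (𝒞 : Submodule F (MCSpace F m n))
    (X : (i : Fin ℓ) → Finset (Fin (m i))) (Y : (i : Fin ℓ) → Finset (Fin (n i))) :
    Submodule F (MCSpace F (fun i => m i - (X i).card) (fun i => n i - (Y i).card)) :=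
  Submodule.map (projMCLin X Y) (𝒞 ⊓ zeroOnMC X Y)

/-- The standard (trace / entrywise) inner product on `MCSpace F m n`. -/
def innerMC (C D : MCSpace F m n) : F := ∑ i, ∑ a, ∑ b, C i a b * D i a b

/-- The dual code with respect to the entrywise inner product. -/
def dualMC (𝒞 : Submodule F (MCSpace F m n)) : Submodule F (MCSpace F m n) where
  carrier := {D | ∀ C ∈ 𝒞, innerMC C D = 0}
  zero_mem' := by intro C _; simp [innerMC]
  add_mem' := by
    intro D E hD hE C hC
    have h1 := hD C hC
    have h2 := hE C hC
    simp only [innerMC] at h1 h2 ⊢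
    simp only [Pi.add_apply, Matrix.add_apply, mul_add, Finset.sum_add_distrib, h1, h2, add_zero]
  smul_mem' := by
    intro c D hD C hC
    have h1 := hD C hC
    simp only [innerMC] at h1 ⊢
    simp only [Pi.smul_apply, Matrix.smul_apply, smul_eq_mul, mul_left_comm, ← Finset.mul_sum,
      h1, mul_zero]

/-- `𝒞` is a maximum multi-cover distance (MMCD) code: it attains the Singleton bound,
where `j` and `δ` are the (unique) integers with `d_MC(𝒞) - 1 = Σ_{i<j} n_i + δ`,
`0 ≤ δ ≤ n_j - 1`. -/
noncomputable def IsMMCD (𝒞 : Set (MCSpace F m n)) : Prop :=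
  ∃ (j : Fin ℓ) (δ : ℕ), δ ≤ n j - 1 ∧
    dMC 𝒞 - 1 = (∑ i ∈ Finset.Iio j, n i) + δ ∧
    𝒞.ncard = (Fintype.card F) ^ ((∑ i ∈ Finset.Ici j, m i * n i) - m j * δ)

/-- The sum-rank weight. -/
noncomputable def wtSR (C : MCSpace F m n) : ℕ := ∑ i, (C i).rank

/-- The minimum sum-rank distance of a code. -/
noncomputable def dSR (𝒞 : Set (MCSpace F m n)) : ℕ :=
  sInf {r | ∃ C ∈ 𝒞, ∃ D ∈ 𝒞, C ≠ D ∧ wtSR (C - D) = r}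

/-- The cover weight of a single matrix. -/
noncomputable def coverWt {m n : ℕ} (C : Matrix (Fin m) (Fin n) F) : ℕ :=
  sInf {r | ∃ (X : Finset (Fin m)) (Y : Finset (Fin n)),
    (∀ a b, C a b ≠ 0 → a ∈ X ∨ b ∈ Y) ∧ X.card + Y.card = r}

end Defs

/-- `S_r^{m,n}`: the number of `m × n` matrices over `F` of cover weight exactly `r`. -/
noncomputable def Scount (F : Type*) [Field F] [Fintype F] (m n r : ℕ) : ℕ :=
  Set.ncard {C : Matrix (Fin m) (Fin n) F | coverWt C = r}

theorem wtMC_spec {F : Type*} [Field F] [Fintype F] {ℓ : ℕ} {m n : Fin ℓ → ℕ}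
    (C : MCSpace F m n) : ∃ X Y, IsMultiCover X Y C ∧ mcSize X Y = wtMC C := by
  have h : ({r | ∃ X Y, IsMultiCover X Y C ∧ mcSize X Y = r} : Set ℕ).Nonempty :=
    ⟨_, fun _ => Finset.univ, fun _ => Finset.univ, fun _ _ _ _ => Or.inl (Finset.mem_univ _), rfl⟩
  exact Nat.sInf_mem h

theorem wtMC_sub_le {F : Type*} [Field F] [Fintype F] {ℓ : ℕ} {m n : Fin ℓ → ℕ}
    (C D : MCSpace F m n) : wtMC (C - D) ≤ wtMC C + wtMC D := by
  classical
  obtain ⟨X, Y, h, e⟩ := wtMC_spec C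
  obtain ⟨X', Y', h', e'⟩ := wtMC_spec D
  have key : wtMC (C - D) ≤ mcSize (fun i => X i ∪ X' i) (fun i => Y i ∪ Y' i) := by
    refine Nat.sInf_le ⟨_, _, ?_, rfl⟩
    intro i a b hab
    by_cases hc : C i a b = 0
    · have hd : D i a b ≠ 0 := by
        intro hd
        exact hab (by simp [hc, hd])
      have := h' i a b hd
      simp only [Finset.mem_union]
      tauto
    · have := h i a b hc
      simp only [Finset.mem_union]
      tauto
  refine key.trans ?_
  rw [← e, ← e']
  unfold mcSize
  rw [← Finset.sum_add_distrib]
  refine Finset.sum_le_sum fun i _ => ?_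
  have h1 := Finset.card_union_le (X i) (X' i)
  have h2 := Finset.card_union_le (Y i) (Y' i)
  beta_reduce
  omega

theorem wtMC_eq_zero {F : Type*} [Field F] [Fintype F] {ℓ : ℕ} {m n : Fin ℓ → ℕ}
    (C : MCSpace F m n) (h0 : wtMC C = 0) : C = 0 := by
  obtain ⟨X, Y, h, e⟩ := wtMC_spec C
  rw [h0] at e
  simp only [mcSize, Finset.sum_eq_zero_iff, Finset.mem_univ, true_implies, Nat.add_eq_zero_iff,
    Finset.card_eq_zero] at e
  funext i
  ext a b
  by_contra hab
  have := h i a b hab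
  rw [(e i).1, (e i).2] at this
  simp at this

/-- the sphere-packing bound for the multi-cover metric. -/
theorem sphere_packing_MC {F : Type*} [Field F] [Fintype F] {ℓ : ℕ} {m n : Fin ℓ → ℕ}
    (hm : ∀ i, 0 < m i) (hn : ∀ i, 0 < n i)
    (𝒞 : Set (MCSpace F m n)) (h𝒞 : 1 < 𝒞.ncard) :
    Set.ncard {C : MCSpace F m n | wtMC C ≤ (dMC 𝒞 - 1) / 2} * 𝒞.ncard
      ≤ (Fintype.card F) ^ (∑ i, m i * n i) := by
  have hfin : Finite (MCSpace F m n) := by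
    unfold MCSpace Matrix
    infer_instance
  have hcard : Nat.card (MCSpace F m n) = (Fintype.card F) ^ (∑ i, m i * n i) := by
    rw [Nat.card_pi, ← Finset.prod_pow_eq_pow_sum]
    refine Finset.prod_congr rfl fun i _ => ?_
    have : Nat.card (Matrix (Fin (m i)) (Fin (n i)) F)
        = Nat.card (Fin (m i) → Fin (n i) → F) := rfl
    rw [this]
    simp [Nat.card_fun, ← pow_mul, mul_comm]
  rw [← Set.ncard_prod, ← hcard, ← Set.ncard_univ]
  refine Set.ncard_le_ncard_of_injOn (fun p => p.2 + p.1) (fun _ _ => Set.mem_univ _) ?_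
    Set.finite_univ
  rintro ⟨E, C⟩ ⟨hE, hC⟩ ⟨E', C'⟩ ⟨hE', hC'⟩ heq
  simp only [Set.mem_setOf_eq] at hE hE' hC hC' heq
  by_cases hCC : C = C'
  · subst hCC
    rw [add_left_cancel heq]
  · exfalso
    have h1 : C - C' = E' - E := by
      rw [sub_eq_sub_iff_add_eq_add, heq, add_comm]
    have h2 := wtMC_sub_le E' E
    rw [← h1] at h2
    have h3 : dMC 𝒞 ≤ wtMC (C - C') := Nat.sInf_le ⟨C, hC, C', hC', hCC, rfl⟩
    have h4 : wtMC (C - C') ≠ 0 := fun h => hCC (sub_eq_zero.mp (wtMC_eq_zero _ h))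
    omega
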